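/- arXiv:0907.1598 — 2 statements merged into one kernel-verified Lean document; each statement's English description precedes it below -/
import Mathlib

section
/- The rearrangement of a Lévy density is a Lévy density: Let φ : ℝ^d → [0,∞) be a measurable function satisfying ∫_{ℝ^d} |y|²/(1+|y|²) φ(y) dy < ∞. Then φ vanishes at infinity (so that its symmetric decreasing rearrangement φ* is defined), and ∫_{ℝ^d} |y|²/(1+|y|²) φ*(y) dy ≤ ∫_{ℝ^d} |y|²/(1+|y|²) φ(y) dy; in particular the left-hand side is finite. -/
open MeasureTheory ENNReal Filter Topology
open scoped RealInnerProductSpace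

/-- A nonnegative function on `ℝ^d` vanishes at infinity if all its positive
super-level sets have finite Lebesgue measure. -/
def VanishesAtInfinity {d : ℕ} (f : EuclideanSpace ℝ (Fin d) → ℝ) : Prop :=
  ∀ t : ℝ, 0 < t → volume {x : EuclideanSpace ℝ (Fin d) | t < f x} < ⊤

/-- Radius of the ball centered at the origin having the same volume as `A`. -/
noncomputable def symmRadius {d : ℕ} (A : Set (EuclideanSpace ℝ (Fin d))) : ℝ :=
  ((volume A / volume (Metric.ball (0 : EuclideanSpace ℝ (Fin d)) 1)).toReal) ^ ((1 : ℝ) / d)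

/-- `A*`: the open ball centered at the origin with the same Lebesgue measure as `A`. -/
noncomputable def ballStar {d : ℕ} (A : Set (EuclideanSpace ℝ (Fin d))) :
    Set (EuclideanSpace ℝ (Fin d)) :=
  Metric.ball 0 (symmRadius A)

/-- Symmetric decreasing rearrangement `f*` (with values in `[0,∞]`):
`f*(x) = ∫₀^∞ 1_{{f>t}*}(x) dt`. -/
noncomputable def symmRearrange {d : ℕ} (f : EuclideanSpace ℝ (Fin d) → ℝ)
    (x : EuclideanSpace ℝ (Fin d)) : ℝ≥0∞ :=
  ∫⁻ t in Set.Ioi (0 : ℝ), (ballStar {y | t < f y}).indicator (fun _ => (1 : ℝ≥0∞)) x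


theorem lintegral_mul_lintegral_indicator {α β : Type*} [MeasurableSpace α] [MeasurableSpace β]
    {μ : Measure α} {ν : Measure β} [SFinite μ] [SFinite ν] {w : α → ℝ≥0∞} (hw : Measurable w)
    (S : β → Set α) (hS : MeasurableSet {p : α × β | p.1 ∈ S p.2}) :
    ∫⁻ y, w y * ∫⁻ t, (S t).indicator (fun _ => (1 : ℝ≥0∞)) y ∂ν ∂μ =
      ∫⁻ t, ∫⁻ y in S t, w y ∂μ ∂ν := by
  have hm : Measurable fun p : α × β => (S p.2).indicator (fun _ => (1 : ℝ≥0∞)) p.1 :=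
    (measurable_const (a := (1 : ℝ≥0∞))).indicator hS
  calc ∫⁻ y, w y * ∫⁻ t, (S t).indicator (fun _ => (1 : ℝ≥0∞)) y ∂ν ∂μ
      = ∫⁻ y, ∫⁻ t, w y * (S t).indicator (fun _ => (1 : ℝ≥0∞)) y ∂ν ∂μ := by
        refine lintegral_congr fun y => (lintegral_const_mul _ ?_).symm
        exact hm.comp measurable_prodMk_left
    _ = ∫⁻ t, ∫⁻ y, w y * (S t).indicator (fun _ => (1 : ℝ≥0∞)) y ∂μ ∂ν :=
        lintegral_lintegral_swap ((hw.comp measurable_fst).mul hm).aemeasurable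
    _ = ∫⁻ t, ∫⁻ y in S t, w y ∂μ ∂ν := by
        refine lintegral_congr fun t => ?_
        have hSt : MeasurableSet (S t) := measurable_prodMk_right hS
        rw [← lintegral_indicator hSt]
        refine lintegral_congr fun y => ?_
        by_cases h : y ∈ S t <;> simp [h]

theorem volume_ballStar {d : ℕ} (hd : 1 ≤ d) {A : Set (EuclideanSpace ℝ (Fin d))}
    (hA : volume A ≠ ⊤) : volume (ballStar A) = volume A := by
  have : Nonempty (Fin d) := ⟨⟨0, hd⟩⟩
  have hd' : (d : ℝ) ≠ 0 := by positivity
  have hb0 : volume (Metric.ball (0 : EuclideanSpace ℝ (Fin d)) 1) ≠ 0 :=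
    (Metric.measure_ball_pos _ _ one_pos).ne'
  have hbt : volume (Metric.ball (0 : EuclideanSpace ℝ (Fin d)) 1) ≠ ⊤ := measure_ball_lt_top.ne
  have hr : 0 ≤ symmRadius A := Real.rpow_nonneg toReal_nonneg _
  have hpow : symmRadius A ^ d =
      (volume A / volume (Metric.ball (0 : EuclideanSpace ℝ (Fin d)) 1)).toReal := by
    rw [symmRadius, ← Real.rpow_natCast, ← Real.rpow_mul toReal_nonneg,
      one_div_mul_cancel hd', Real.rpow_one]
  rw [ballStar, Measure.addHaar_ball _ _ hr, finrank_euclideanSpace_fin, hpow,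
    ENNReal.ofReal_toReal (ENNReal.div_ne_top hA hb0), ENNReal.div_mul_cancel hb0 hbt]

/-- **Bathtub principle**: a radially nondecreasing weight has smaller mass on `A*` than on `A`. -/
theorem setLIntegral_ballStar_le {d : ℕ} (hd : 1 ≤ d) {A : Set (EuclideanSpace ℝ (Fin d))}
    (hA : MeasurableSet A) (hA' : volume A ≠ ⊤) {g : ℝ → ℝ≥0∞} (hg : MonotoneOn g (Set.Ici 0)) :
    ∫⁻ y in ballStar A, g ‖y‖ ≤ ∫⁻ y in A, g ‖y‖ := by
  have hB : MeasurableSet (ballStar A) := Metric.isOpen_ball.measurableSet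
  have hr : 0 ≤ symmRadius A := Real.rpow_nonneg toReal_nonneg _
  have hdiff : volume (ballStar A \ A) = volume (A \ ballStar A) := by
    have h1 := measure_inter_add_sdiff (μ := volume) (ballStar A) hA
    have h2 := measure_inter_add_sdiff (μ := volume) A hB
    rw [Set.inter_comm, volume_ballStar hd hA', ← h2] at h1
    exact (ENNReal.add_right_inj (measure_ne_top_of_subset Set.inter_subset_left hA')).1 h1
  rw [← lintegral_inter_add_sdiff (fun y => g ‖y‖) (ballStar A) hA,
    ← lintegral_inter_add_sdiff (fun y => g ‖y‖) A hB, Set.inter_comm]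
  refine add_le_add le_rfl ?_
  calc ∫⁻ y in ballStar A \ A, g ‖y‖
      ≤ ∫⁻ _ in ballStar A \ A, g (symmRadius A) := by
        refine setLIntegral_mono measurable_const fun y hy => ?_
        exact hg (norm_nonneg y) hr (mem_ball_zero_iff.1 hy.1).le
    _ = ∫⁻ _ in A \ ballStar A, g (symmRadius A) := by
        rw [setLIntegral_const, setLIntegral_const, hdiff]
    _ ≤ ∫⁻ y in A \ ballStar A, g ‖y‖ := by
        refine setLIntegral_mono' (hA.diff hB) fun y hy => ?_
        exact hg hr (norm_nonneg y) (not_lt.1 fun h => hy.2 (mem_ball_zero_iff.2 h))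

theorem monotoneOn_sq_div_one_add_sq :
    MonotoneOn (fun r : ℝ => r ^ 2 / (1 + r ^ 2)) (Set.Ici 0) := by
  intro a ha b _ hab
  have h : a ^ 2 ≤ b ^ 2 := pow_le_pow_left₀ ha hab 2
  simp only
  rw [div_le_div_iff₀ (by positivity) (by positivity)]
  nlinarith

theorem vanishesAtInfinity_of_lintegral_lt_top {d : ℕ} {φ : EuclideanSpace ℝ (Fin d) → ℝ}
    (hφ_meas : Measurable φ)
    (hφ : ∫⁻ y, ENNReal.ofReal (‖y‖ ^ 2 / (1 + ‖y‖ ^ 2) * φ y) < ⊤) :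
    VanishesAtInfinity φ := by
  intro t ht
  have hm : Measurable fun y => ENNReal.ofReal (‖y‖ ^ 2 / (1 + ‖y‖ ^ 2) * φ y) := by fun_prop
  have hsub : {x | t < φ x} ⊆ Metric.ball 0 1 ∪
      {y | ENNReal.ofReal (t / 2) ≤ ENNReal.ofReal (‖y‖ ^ 2 / (1 + ‖y‖ ^ 2) * φ y)} := by
    intro y hy
    by_cases h : ‖y‖ < 1
    · exact Or.inl (mem_ball_zero_iff.2 h)
    · refine Or.inr (ENNReal.ofReal_le_ofReal ?_)
      have hw := monotoneOn_sq_div_one_add_sq (Set.mem_Ici.2 zero_le_one)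
        (Set.mem_Ici.2 (norm_nonneg y)) (not_lt.1 h)
      norm_num at hw
      have hy' : t < φ y := hy
      calc t / 2 = 1 / 2 * t := by ring
        _ ≤ _ := mul_le_mul hw hy'.le ht.le (by positivity)
  refine (measure_mono hsub).trans_lt ((measure_union_le _ _).trans_lt ?_)
  refine ENNReal.add_lt_top.2 ⟨measure_ball_lt_top, ?_⟩
  have hpos : ENNReal.ofReal (t / 2) ≠ 0 := (ENNReal.ofReal_pos.2 (half_pos ht)).ne'
  refine (meas_ge_le_lintegral_div hm.aemeasurable hpos ENNReal.ofReal_ne_top).trans_lt ?_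
  exact ENNReal.div_lt_top hφ.ne hpos

theorem measurable_symmRadius_superlevel {d : ℕ} (f : EuclideanSpace ℝ (Fin d) → ℝ) :
    Measurable fun t : ℝ => symmRadius {y | t < f y} := by
  have h : Antitone fun t : ℝ => volume {y | t < f y} := fun s t hst =>
    measure_mono fun y (hy : t < f y) => hst.trans_lt hy
  exact ((h.measurable.div_const _).ennreal_toReal).pow_const _

theorem lintegral_mul_symmRearrange {d : ℕ} (f : EuclideanSpace ℝ (Fin d) → ℝ)
    {w : EuclideanSpace ℝ (Fin d) → ℝ≥0∞} (hw : Measurable w) :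
    ∫⁻ y, w y * symmRearrange f y =
      ∫⁻ t in Set.Ioi (0 : ℝ), ∫⁻ y in ballStar {y | t < f y}, w y := by
  have hS : MeasurableSet {p : EuclideanSpace ℝ (Fin d) × ℝ | p.1 ∈ ballStar {y | p.2 < f y}} := by
    simp only [ballStar, mem_ball_zero_iff]
    exact measurableSet_lt measurable_fst.norm
      ((measurable_symmRadius_superlevel f).comp measurable_snd)
  exact lintegral_mul_lintegral_indicator hw (fun t => ballStar {y | t < f y}) hS

theorem lintegral_mul_ofReal_eq_lintegral_superlevel {d : ℕ} {f : EuclideanSpace ℝ (Fin d) → ℝ}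
    (hf : Measurable f) {w : EuclideanSpace ℝ (Fin d) → ℝ≥0∞} (hw : Measurable w) :
    ∫⁻ y, w y * ENNReal.ofReal (f y) =
      ∫⁻ t in Set.Ioi (0 : ℝ), ∫⁻ y in {y | t < f y}, w y := by
  rw [← lintegral_mul_lintegral_indicator hw (fun t => {y | t < f y})
    (measurableSet_lt measurable_snd (hf.comp measurable_fst))]
  refine lintegral_congr fun y => ?_
  congr 1
  have h : (fun t : ℝ => {y | t < f y}.indicator (fun _ => (1 : ℝ≥0∞)) y) =
      (Set.Iio (f y)).indicator 1 := by
    ext t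
    simp [Set.indicator_apply]
  rw [h, lintegral_indicator_one measurableSet_Iio, Measure.restrict_apply measurableSet_Iio,
    Set.Iio_inter_Ioi, Real.volume_Ioo, sub_zero]

/-- **The rearrangement of a Lévy density is a Lévy density.** -/
theorem levy_density_rearrangement {d : ℕ} (hd : 1 ≤ d)
    (φ : EuclideanSpace ℝ (Fin d) → ℝ) (hφ_meas : Measurable φ)
    (hφ_nonneg : ∀ y, 0 ≤ φ y)
    (hφ_int : ∫⁻ y, ENNReal.ofReal (‖y‖ ^ 2 / (1 + ‖y‖ ^ 2) * φ y) < ⊤) :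
    VanishesAtInfinity φ ∧
      (∫⁻ y, ENNReal.ofReal (‖y‖ ^ 2 / (1 + ‖y‖ ^ 2)) * symmRearrange φ y) ≤
        ∫⁻ y, ENNReal.ofReal (‖y‖ ^ 2 / (1 + ‖y‖ ^ 2) * φ y) := by
  have hvan := vanishesAtInfinity_of_lintegral_lt_top hφ_meas hφ_int
  refine ⟨hvan, ?_⟩
  have hw : Measurable fun y : EuclideanSpace ℝ (Fin d) =>
      ENNReal.ofReal (‖y‖ ^ 2 / (1 + ‖y‖ ^ 2)) := by fun_prop
  have hrhs : ∀ y, ENNReal.ofReal (‖y‖ ^ 2 / (1 + ‖y‖ ^ 2) * φ y) =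
      ENNReal.ofReal (‖y‖ ^ 2 / (1 + ‖y‖ ^ 2)) * ENNReal.ofReal (φ y) := fun y =>
    ENNReal.ofReal_mul (by positivity)
  rw [lintegral_congr hrhs, lintegral_mul_symmRearrange φ hw,
    lintegral_mul_ofReal_eq_lintegral_superlevel hφ_meas hw]
  refine setLIntegral_mono' measurableSet_Ioi fun t ht => ?_
  exact setLIntegral_ballStar_le hd (measurableSet_lt measurable_const hφ_meas) (hvan t ht).ne
    (g := fun r => ENNReal.ofReal (r ^ 2 / (1 + r ^ 2)))
    fun a ha b hb hab => ENNReal.ofReal_le_ofReal (monotoneOn_sq_div_one_add_sq ha hb hab)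
end

section
/- Symmetrized approximation of the indicator of an open set: Let O ⊆ ℝ^d be a nonempty open set of finite Lebesgue measure. For n ≥ 1 define ψ_n(x) = 1 − max(1 − n·dist(x, ℝ^d∖O), 0), let O_n = {x ∈ ℝ^d : dist(x, ℝ^d∖O) > 1/n}, and let r_n, r ≥ 0 be such that the open balls B(0,r_n) and B(0,r) have the same Lebesgue measure as O_n and O respectively. Then for every n and every x ∈ ℝ^d, 1_{B(0,r_n)}(x) ≤ ψ_n*(x) ≤ 1_{B(0,r)}(x), and lim_{n→∞} ψ_n*(x) = 1_{B(0,r)}(x) for every x ∈ ℝ^d. -/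
open MeasureTheory ENNReal Filter Topology
open scoped RealInnerProductSpace

/-- `ψ_n(x) = 1 - (1 - n·dist(x, ℝ^d ∖ O))₊`. -/
noncomputable def psiApprox {d : ℕ} (O : Set (EuclideanSpace ℝ (Fin d))) (n : ℕ)
    (x : EuclideanSpace ℝ (Fin d)) : ℝ :=
  1 - max (1 - (n : ℝ) * Metric.infDist x Oᶜ) 0

theorem symmRadius_eq_of_volume_ball_eq {d : ℕ} (hd : 1 ≤ d) {A : Set (EuclideanSpace ℝ (Fin d))}
    {s : ℝ} (hs : 0 ≤ s)
    (h : volume (Metric.ball (0 : EuclideanSpace ℝ (Fin d)) s) = volume A) :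
    symmRadius A = s := by
  have : Nonempty (Fin d) := ⟨⟨0, hd⟩⟩
  have h1 : volume (Metric.ball (0 : EuclideanSpace ℝ (Fin d)) 1) ≠ 0 :=
    (Metric.measure_ball_pos _ _ one_pos).ne'
  rw [symmRadius, ← h, Measure.addHaar_ball _ _ hs, finrank_euclideanSpace_fin,
    ENNReal.mul_div_cancel_right h1 measure_ball_lt_top.ne, ENNReal.toReal_ofReal (by positivity),
    one_div, Real.pow_rpow_inv_natCast hs (by lia)]

theorem symmRadius_mono {d : ℕ} {A B : Set (EuclideanSpace ℝ (Fin d))} (h : A ⊆ B)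
    (hB : volume B < ⊤) : symmRadius A ≤ symmRadius B := by
  have h1 : volume (Metric.ball (0 : EuclideanSpace ℝ (Fin d)) 1) ≠ 0 :=
    (Metric.measure_ball_pos _ _ one_pos).ne'
  unfold symmRadius
  gcongr
  exact ENNReal.div_ne_top hB.ne h1

theorem ballStar_mono {d : ℕ} {A B : Set (EuclideanSpace ℝ (Fin d))} (h : A ⊆ B)
    (hB : volume B < ⊤) : ballStar A ⊆ ballStar B :=
  Metric.ball_subset_ball (symmRadius_mono h hB)

theorem ballStar_eq_ball {d : ℕ} (hd : 1 ≤ d) {A : Set (EuclideanSpace ℝ (Fin d))} {s : ℝ}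
    (hs : 0 ≤ s) (h : volume (Metric.ball (0 : EuclideanSpace ℝ (Fin d)) s) = volume A) :
    ballStar A = Metric.ball 0 s := by
  rw [ballStar, symmRadius_eq_of_volume_ball_eq hd hs h]

theorem ballStar_empty {d : ℕ} (hd : 1 ≤ d) :
    ballStar (∅ : Set (EuclideanSpace ℝ (Fin d))) = ∅ := by
  rw [ballStar_eq_ball hd le_rfl (by simp), Metric.ball_zero]

theorem indicator_ballStar_le_symmRearrange {d : ℕ} {f : EuclideanSpace ℝ (Fin d) → ℝ}
    {A : Set (EuclideanSpace ℝ (Fin d))} (hf : VanishesAtInfinity f)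
    (hA : ∀ y ∈ A, 1 ≤ f y) (x : EuclideanSpace ℝ (Fin d)) :
    (ballStar A).indicator (fun _ => (1 : ℝ≥0∞)) x ≤ symmRearrange f x := by
  refine Set.indicator_apply_le fun hx => ?_
  calc (1 : ℝ≥0∞) = ∫⁻ _ in Set.Ioo (0 : ℝ) 1, 1 := by simp
    _ ≤ ∫⁻ t in Set.Ioo (0 : ℝ) 1, (ballStar {y | t < f y}).indicator (fun _ => (1 : ℝ≥0∞)) x := by
        refine setLIntegral_mono' measurableSet_Ioo fun t ht => ?_
        rw [Set.indicator_of_mem]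
        exact ballStar_mono (fun y hy => ht.2.trans_le (hA y hy)) (hf t ht.1) hx
    _ ≤ symmRearrange f x := lintegral_mono_set Set.Ioo_subset_Ioi_self

theorem symmRearrange_le_indicator_ballStar {d : ℕ} (hd : 1 ≤ d)
    {f : EuclideanSpace ℝ (Fin d) → ℝ} {A : Set (EuclideanSpace ℝ (Fin d))} (hA : volume A < ⊤)
    (hf : ∀ y, f y ≤ 1) (hfA : ∀ y, 0 < f y → y ∈ A) (x : EuclideanSpace ℝ (Fin d)) :
    symmRearrange f x ≤ (ballStar A).indicator (fun _ => (1 : ℝ≥0∞)) x := by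
  calc symmRearrange f x
      ≤ ∫⁻ t in Set.Ioi (0 : ℝ), (Set.Iio (1 : ℝ)).indicator
          (fun _ => (ballStar A).indicator (fun _ => (1 : ℝ≥0∞)) x) t := by
        refine setLIntegral_mono' measurableSet_Ioi fun t ht => ?_
        by_cases ht1 : t < 1
        · rw [Set.indicator_of_mem (Set.mem_Iio.2 ht1)]
          exact Set.indicator_le_indicator_of_subset
            (ballStar_mono (fun y hy => hfA y (lt_trans ht hy)) hA) (fun _ => zero_le) x
        · have : {y | t < f y} = ∅ :=
            Set.eq_empty_of_forall_notMem fun y hy => ht1 (lt_of_lt_of_le hy (hf y))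
          simp [this, ballStar_empty hd]
    _ = (ballStar A).indicator (fun _ => (1 : ℝ≥0∞)) x := by
        rw [setLIntegral_indicator measurableSet_Iio, setLIntegral_const, Set.inter_comm,
          Set.Ioi_inter_Iio]
        simp

theorem psiApprox_le_one {d : ℕ} (O : Set (EuclideanSpace ℝ (Fin d))) (n : ℕ)
    (x : EuclideanSpace ℝ (Fin d)) : psiApprox O n x ≤ 1 :=
  sub_le_self _ (le_max_right _ _)

theorem mem_of_psiApprox_pos {d : ℕ} {O : Set (EuclideanSpace ℝ (Fin d))} {n : ℕ}
    {x : EuclideanSpace ℝ (Fin d)} (h : 0 < psiApprox O n x) : x ∈ O := by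
  by_contra hx
  simp [psiApprox, Metric.infDist_zero_of_mem (Set.mem_compl hx)] at h

theorem one_le_psiApprox {d : ℕ} {O : Set (EuclideanSpace ℝ (Fin d))} {n : ℕ} (hn : 1 ≤ n)
    {x : EuclideanSpace ℝ (Fin d)} (h : 1 / (n : ℝ) < Metric.infDist x Oᶜ) :
    1 ≤ psiApprox O n x := by
  rw [div_lt_iff₀' (by positivity)] at h
  rw [psiApprox, max_eq_right (by linarith), sub_zero]

theorem vanishesAtInfinity_psiApprox {d : ℕ} {O : Set (EuclideanSpace ℝ (Fin d))}
    (hO : volume O < ⊤) (n : ℕ) : VanishesAtInfinity (psiApprox O n) := fun _ ht =>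
  (measure_mono fun _ hx => mem_of_psiApprox_pos (ht.trans hx)).trans_lt hO

theorem eventually_lt_measure_one_div_lt_infDist_compl {X : Type*} [PseudoMetricSpace X]
    [MeasurableSpace X] (μ : Measure X) {O : Set X} (hO : IsOpen O) (hO_ne : Oᶜ.Nonempty)
    {c : ℝ≥0∞} (hc : c < μ O) :
    ∀ᶠ n : ℕ in atTop, c < μ {x | 1 / (n : ℝ) < Metric.infDist x Oᶜ} := by
  set S : ℕ → Set X := fun n => {x | 1 / ((n : ℝ) + 1) < Metric.infDist x Oᶜ} with hS
  have hmono : Monotone S := fun m n hmn => Set.ofPred_subset_ofPred.2 fun x hx =>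
    (Nat.one_div_le_one_div hmn).trans_lt hx
  have hsub : O ⊆ ⋃ n, S n := fun x hx => by
    have hpos : 0 < Metric.infDist x Oᶜ :=
      (hO.isClosed_compl.notMem_iff_infDist_pos hO_ne).1 (by simpa using hx)
    exact Set.mem_iUnion.2 (exists_nat_one_div_lt hpos)
  have hlim := tendsto_measure_iUnion_atTop (μ := μ) hmono
  have hev := hlim.eventually_const_lt (hc.trans_le (measure_mono hsub))
  rw [← map_add_atTop_eq_nat 1, eventually_map]
  simpa [hS] using hev

/-- **Symmetrized approximation of the indicator of an open set.** -/
theorem indicator_symm_approx {d : ℕ} (hd : 1 ≤ d)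
    (O : Set (EuclideanSpace ℝ (Fin d))) (hO_open : IsOpen O) (hO_ne : O.Nonempty)
    (hO_vol : volume O < ⊤)
    (r : ℝ) (hr : 0 ≤ r)
    (hr_vol : volume (Metric.ball (0 : EuclideanSpace ℝ (Fin d)) r) = volume O)
    (rn : ℕ → ℝ) (hrn : ∀ n, 0 ≤ rn n)
    (hrn_vol : ∀ n, volume (Metric.ball (0 : EuclideanSpace ℝ (Fin d)) (rn n)) =
      volume {x : EuclideanSpace ℝ (Fin d) | 1 / (n : ℝ) < Metric.infDist x Oᶜ}) :
    (∀ n, 1 ≤ n → ∀ x,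
        (Metric.ball (0 : EuclideanSpace ℝ (Fin d)) (rn n)).indicator
            (fun _ => (1 : ℝ≥0∞)) x ≤ symmRearrange (psiApprox O n) x ∧
          symmRearrange (psiApprox O n) x ≤
            (Metric.ball (0 : EuclideanSpace ℝ (Fin d)) r).indicator
              (fun _ => (1 : ℝ≥0∞)) x) ∧
      ∀ x, Filter.Tendsto (fun n => symmRearrange (psiApprox O n) x) Filter.atTop
        (nhds ((Metric.ball (0 : EuclideanSpace ℝ (Fin d)) r).indicator
          (fun _ => (1 : ℝ≥0∞)) x)) := by
  have hO_star : ballStar O = Metric.ball 0 r := ballStar_eq_ball hd hr hr_vol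
  have hbounds : ∀ n, 1 ≤ n → ∀ x,
      (Metric.ball (0 : EuclideanSpace ℝ (Fin d)) (rn n)).indicator
          (fun _ => (1 : ℝ≥0∞)) x ≤ symmRearrange (psiApprox O n) x ∧
        symmRearrange (psiApprox O n) x ≤
          (Metric.ball (0 : EuclideanSpace ℝ (Fin d)) r).indicator
            (fun _ => (1 : ℝ≥0∞)) x := by
    intro n hn x
    rw [← hO_star, ← ballStar_eq_ball hd (hrn n) (hrn_vol n)]
    exact ⟨indicator_ballStar_le_symmRearrange (vanishesAtInfinity_psiApprox hO_vol n)
        (fun y hy => one_le_psiApprox hn hy) x,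
      symmRearrange_le_indicator_ballStar hd hO_vol (psiApprox_le_one O n)
        (fun y hy => mem_of_psiApprox_pos hy) x⟩
  refine ⟨hbounds, fun x => tendsto_const_nhds.congr' ?_⟩
  by_cases hx : x ∈ Metric.ball (0 : EuclideanSpace ℝ (Fin d)) r
  · have : Nonempty (Fin d) := ⟨⟨0, hd⟩⟩
    have hO_compl : Oᶜ.Nonempty := by
      rw [Set.nonempty_compl]
      rintro rfl
      exact hO_vol.ne (measure_univ_of_isAddLeftInvariant _)
    have hx_vol : volume (Metric.ball (0 : EuclideanSpace ℝ (Fin d)) ‖x‖) < volume O := by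
      rw [← hr_vol, Measure.addHaar_ball _ _ (norm_nonneg x), Measure.addHaar_ball _ _ hr]
      refine ENNReal.mul_lt_mul_left (Metric.measure_ball_pos _ _ one_pos).ne'
        measure_ball_lt_top.ne ?_
      have hxr : ‖x‖ < r := by simpa using hx
      rw [finrank_euclideanSpace_fin,
        ENNReal.ofReal_lt_ofReal_iff (pow_pos ((norm_nonneg x).trans_lt hxr) d)]
      exact pow_lt_pow_left₀ hxr (norm_nonneg x) (by lia)
    filter_upwards [eventually_ge_atTop 1,
      eventually_lt_measure_one_div_lt_infDist_compl volume hO_open hO_compl hx_vol] with n hn hlt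
    refine le_antisymm ?_ (hbounds n hn x).2
    refine le_trans ?_ (hbounds n hn x).1
    rw [← hrn_vol n] at hlt
    have hxn : ‖x‖ < rn n := by
      by_contra! hle
      exact hlt.not_ge (measure_mono (Metric.ball_subset_ball hle))
    rw [Set.indicator_of_mem hx, Set.indicator_of_mem (by simpa using hxn)]
  · filter_upwards [eventually_ge_atTop 1] with n hn
    have h := (hbounds n hn x).2
    rw [Set.indicator_of_notMem hx] at h ⊢
    exact (nonpos_iff_eq_zero.1 h).symm
end
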